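/- Let G be a finite group, H a normal subgroup of G, and λ : H → ℂˣ a group homomorphism with λ² = 1 (i.e., λ(h)² = 1 for all h ∈ H; this holds in particular when H has exponent 2). Then for every irreducible complex character ψ of the quotient group G/H, the inflation (lift) of ψ to G is a constituent of (Ind_H^G λ)² with multiplicity at least ψ(1); that is, ⟨(Ind_H^G λ)·(Ind_H^G λ), ψ∘π⟩ ≥ ψ(1), where π : G → G/H is the quotient map. -/

import Mathlib

open scoped ComplexOrder

open Classical in
/-- The induced character `Ind_H^G λ` of a degree-one character `λ : H → ℂˣ`,
given by `(Ind_H^G λ)(g) = |H|⁻¹ · Σ_{t ∈ G, t⁻¹gt ∈ H} λ(t⁻¹gt)`. -/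
noncomputable def inducedChar {G : Type} [Group G] [Fintype G] (H : Subgroup G)
    (lam : H →* ℂˣ) : G → ℂ := fun g =>
  (Nat.card H : ℂ)⁻¹ * ∑ t : G, if h : t⁻¹ * g * t ∈ H then (lam ⟨t⁻¹ * g * t, h⟩ : ℂ) else 0

namespace Subgroup

variable {G : Type} [Group G] {H : Subgroup G} [H.Normal]

/-- The conjugate `h ↦ λ(t⁻¹ht)` of a degree-one character `λ` of a normal subgroup. -/
noncomputable def conjChar (lam : H →* ℂˣ) (t : G) : H →* ℂ :=
  (Units.coeHom ℂ).comp (lam.comp (MulAut.conjNormal t⁻¹).toMonoidHom)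

lemma conjChar_apply (lam : H →* ℂˣ) (t : G) (h : H) (hm : t⁻¹ * h * t ∈ H) :
    conjChar lam t h = lam ⟨t⁻¹ * h * t, hm⟩ := by
  have : MulAut.conjNormal t⁻¹ h = ⟨t⁻¹ * h * t, hm⟩ := by
    ext
    simp
  simp [conjChar, ← this]

lemma conjChar_mul_coe (lam : H →* ℂˣ) (t : G) (u : H) :
    conjChar lam (t * u) = conjChar lam t := by
  ext h
  have : MulAut.conjNormal (t * (u : G))⁻¹ h = u⁻¹ * MulAut.conjNormal t⁻¹ h * u := by
    ext
    simp [mul_assoc]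
  simp only [conjChar, MonoidHom.comp_apply, MulEquiv.toMonoidHom_eq_coe, MonoidHom.coe_coe, this]
  simp [mul_right_comm]

lemma conjChar_mul_self {lam : H →* ℂˣ} (hlam : ∀ h : H, lam h ^ 2 = 1) (t : G) :
    conjChar lam t * conjChar lam t = 1 := by
  ext h
  have := congrArg Units.val (hlam (MulAut.conjNormal t⁻¹ h))
  simpa [conjChar, sq] using this

variable [Fintype G]

lemma card_le_sum_sq_sum_conjChar [Fintype H] {lam : H →* ℂˣ} (hlam : ∀ h : H, lam h ^ 2 = 1) :
    (Fintype.card G : ℂ) * (Fintype.card H : ℂ) ^ 2 ≤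
      ∑ h : H, (∑ t : G, conjChar lam t h) * ∑ t : G, conjChar lam t h := by
  classical
  have key : ∀ t u : G, (if u ∈ H then (Fintype.card H : ℂ) else 0) ≤
      ∑ h : H, (conjChar lam t * conjChar lam (t * u)) h := by
    intro t u
    rw [sum_hom_units]
    by_cases hu : u ∈ H
    · have := conjChar_mul_coe lam t ⟨u, hu⟩
      simp only at this
      simp [hu, this, conjChar_mul_self hlam]
    · rw [if_neg hu]
      split_ifs <;> simp
  calc (Fintype.card G : ℂ) * (Fintype.card H : ℂ) ^ 2
      = ∑ _t : G, ∑ u : G, (if u ∈ H then (Fintype.card H : ℂ) else 0) := by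
        rw [Finset.sum_ite, Finset.sum_const_zero, add_zero, Finset.sum_const, Finset.sum_const,
          Finset.card_univ, ← Fintype.card_subtype, nsmul_eq_mul, nsmul_eq_mul, sq]
    _ ≤ ∑ t : G, ∑ u : G, ∑ h : H, (conjChar lam t * conjChar lam (t * u)) h :=
        Finset.sum_le_sum fun t _ => Finset.sum_le_sum fun u _ => key t u
    _ = ∑ t : G, ∑ s : G, ∑ h : H, (conjChar lam t * conjChar lam s) h :=
        Finset.sum_congr rfl fun t _ => Equiv.sum_comp (Equiv.mulLeft t)
          fun s => ∑ h : H, (conjChar lam t * conjChar lam s) h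
    _ = _ := by
        simp_rw [Finset.sum_mul_sum, MonoidHom.mul_apply]
        rw [Finset.sum_comm (s := (Finset.univ : Finset H))]
        exact Finset.sum_congr rfl fun t _ => Finset.sum_comm

lemma inducedChar_coe (lam : H →* ℂˣ) (h : H) :
    inducedChar H lam h = (Nat.card H : ℂ)⁻¹ * ∑ t : G, conjChar lam t h := by
  unfold inducedChar
  congr 1
  refine Finset.sum_congr rfl fun t _ => ?_
  have hm : t⁻¹ * h * t ∈ H := by
    simpa using ‹H.Normal›.conj_mem h h.2 t⁻¹
  rw [dif_pos hm, conjChar_apply lam t h hm]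

lemma inducedChar_eq_zero (lam : H →* ℂˣ) {g : G} (hg : g ∉ H) : inducedChar H lam g = 0 := by
  unfold inducedChar
  rw [Finset.sum_eq_zero, mul_zero]
  intro t _
  refine dif_neg fun hm => hg ?_
  simpa [mul_assoc] using ‹H.Normal›.conj_mem _ hm t

/-- The norm of `Ind_H^G λ` is at least one. -/
lemma card_le_sum_inducedChar_sq [Fintype H] {lam : H →* ℂˣ} (hlam : ∀ h : H, lam h ^ 2 = 1) :
    (Fintype.card G : ℂ) ≤ ∑ h : H, inducedChar H lam h * inducedChar H lam h := by
  have hc : (Fintype.card H : ℂ) ≠ 0 := Nat.cast_ne_zero.2 Fintype.card_ne_zero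
  have hn : (0 : ℂ) ≤ ((Fintype.card H : ℂ)⁻¹) ^ 2 := by simp
  have := mul_le_mul_of_nonneg_left (card_le_sum_sq_sum_conjChar hlam) hn
  calc (Fintype.card G : ℂ)
      = ((Fintype.card H : ℂ)⁻¹) ^ 2 * (Fintype.card G * (Fintype.card H : ℂ) ^ 2) := by
        field_simp
    _ ≤ _ := this
    _ = _ := by
        rw [Finset.mul_sum]
        refine Finset.sum_congr rfl fun h _ => ?_
        rw [inducedChar_coe, Nat.card_eq_fintype_card]
        ring

end Subgroup

/-- If `H ⊴ G` and `λ : H → ℂˣ` satisfies `λ² = 1`, then every irreducible character `ψ` of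
`G/H`, inflated to `G` along the quotient map, occurs in `(Ind_H^G λ)²` with multiplicity at
least `ψ(1)`. -/
theorem sq_inducedChar_contains_inflation (G : Type) [Group G] [Fintype G] (H : Subgroup G)
    (hH : H.Normal) (lam : H →* ℂˣ) (hlam : ∀ h : H, (lam h) ^ 2 = 1)
    (W : FDRep ℂ (G ⧸ H)) (hW : CategoryTheory.Simple W) :
    W.character (1 : G ⧸ H) ≤
      (Fintype.card G : ℂ)⁻¹ * ∑ g : G,
        inducedChar H lam g * inducedChar H lam g *
          (starRingEnd ℂ) (W.character ((QuotientGroup.mk' H) g)) := by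
  classical
  have hsum : ∑ g : G, inducedChar H lam g * inducedChar H lam g *
        (starRingEnd ℂ) (W.character ((QuotientGroup.mk' H) g)) =
      (∑ h : H, inducedChar H lam h * inducedChar H lam h) * W.character 1 := by
    rw [Finset.sum_mul]
    symm
    refine Finset.sum_of_injOn Subtype.val Subtype.val_injective.injOn (by simp) ?_ ?_
    · intro g _ hg
      rw [Subgroup.inducedChar_eq_zero lam (by simpa using hg)]
      simp
    · intro h _
      have : QuotientGroup.mk' H (h : G) = 1 := (QuotientGroup.eq_one_iff _).2 h.2
      rw [this, FDRep.char_one, map_natCast]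
  have hG : (Fintype.card G : ℂ) ≠ 0 := Nat.cast_ne_zero.2 Fintype.card_ne_zero
  have hGn : (0 : ℂ) ≤ (Fintype.card G : ℂ)⁻¹ := by simp
  have hW1 : (0 : ℂ) ≤ W.character 1 := by
    rw [FDRep.char_one]
    exact Nat.cast_nonneg _
  calc W.character 1 = (Fintype.card G : ℂ)⁻¹ * (Fintype.card G * W.character 1) := by
        field_simp
    _ ≤ _ := by
        rw [hsum]
        exact mul_le_mul_of_nonneg_left
          (mul_le_mul_of_nonneg_right (Subgroup.card_le_sum_inducedChar_sq hlam) hW1) hGn
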